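/- Let H be a 1D spin Hamiltonian with more than one spin symbol (q > 1) or with more than one allowed local interaction (|𝓘_{1D}| > 1 with distinct encodings). Then the language L_U of its trivial time evolution is not a context-free language. -/

import Mathlib

/-- The finite alphabet of the language: Σ_q ∪ [p] ∪ auxiliary symbols. -/
inductive Symb (q p : ℕ) : Type where
  | spin (s : Fin q)      -- a spin symbol from Σ_q
  | ham (α : Fin p)       -- a local-Hamiltonian label from [p]
  | lhd                   -- ◁
  | rhd                   -- ▷
  | sq                    -- □
  | dia                   -- ◇
  | tri                   -- ▲
  | blank                 -- ␣
  | comp                  -- ∘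
  | bullet                -- •
  deriving DecidableEq, Fintype

/-- A local interaction `I = (α, A)`: a label `α ∈ [p]` together with a tuple of `k`
addresses, each an integer or the missing-spin symbol ▲ (modelled as `none`). -/
abbrev LocInt (k p : ℕ) := Fin p × (Fin k → Option ℤ)

/-- A configuration `(s_1, I_1, …, s_n, I_n)` (positions are 0-based here). -/
abbrev Config (q k p : ℕ) := List (Fin q × LocInt k p)

/-- The spin addressed by address `a` relative to (0-based) position `j`:
it is `▲` (`none`) whenever `a = ▲` or the addressed position lies outside `[n]`. -/
def spinAt {q k p : ℕ} (x : Config q k p) (j : ℕ) : Option ℤ → Option (Fin q)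
  | none => none
  | some l =>
      if 0 ≤ (j : ℤ) + l then (x[((j : ℤ) + l).toNat]?).map Prod.fst else none

/-- `H(s_1,I_1,…,s_n,I_n) = Σ_{j=1}^n h_{α_j}((s_{j+l})_{l ∈ A_j})`. -/
def energy {q k p : ℕ} (h : Fin p → (Fin k → Option (Fin q)) → ℤ)
    (x : Config q k p) : ℤ :=
  ∑ j : Fin x.length, h (x.get j).2.1 (fun l => spinAt x (j : ℕ) ((x.get j).2.2 l))

/-- The unary encoding `u : ℤ → {◇,□}*`. -/
def unary {q p : ℕ} (z : ℤ) : List (Symb q p) :=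
  if 0 ≤ z then List.replicate z.toNat Symb.dia else List.replicate (-z).toNat Symb.sq

/-- Encoding of an address: `u(a)` for an integer `a`, and `▲` for the missing-spin symbol. -/
def encAddr {q p : ℕ} : Option ℤ → List (Symb q p)
  | none => [Symb.tri]
  | some z => unary z

/-- `γ(α, (a_1,…,a_k)) = α ◁ u(a_1) ␣ ⋯ ␣ u(a_k) ▷`. -/
def encInt {q k p : ℕ} (I : LocInt k p) : List (Symb q p) :=
  [Symb.ham I.1, Symb.lhd] ++
    List.intercalate [Symb.blank] (List.ofFn fun l => encAddr (I.2 l)) ++ [Symb.rhd]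

/-- `e(s_1,I_1,…,s_n,I_n) = s_1 γ(I_1) ⋯ s_n γ(I_n)`. -/
def encConfig {q k p : ℕ} (x : Config q k p) : List (Symb q p) :=
  (x.map fun si => Symb.spin si.1 :: encInt si.2).flatten

/-- The language of the trivial time evolution, `L_U = { e(x) ∘ e(x) • : x ∈ 𝒟 }`. -/
def langU {q k p : ℕ} (D : Set (Config q k p)) : Language (Symb q p) :=
  {w | ∃ x ∈ D, w = encConfig x ++ [Symb.comp] ++ encConfig x ++ [Symb.bullet]}

/-- `𝓘_{1D} ⊆ [p] × {−k,…,k}^k` and nonempty: each address is an integer in `{−k,…,k}`. -/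
def Is1DIntSet {k p : ℕ} (S : Set (LocInt k p)) : Prop :=
  S.Nonempty ∧ ∀ I ∈ S, ∀ l : Fin k, ∃ a : ℤ, I.2 l = some a ∧ -(k : ℤ) ≤ a ∧ a ≤ k

/-- The domain of a 1D spin Hamiltonian with constant interaction set `S = 𝓘_{1D}`:
all configurations of any length `n ≥ 1` with all local interactions drawn from `S`. -/
def Domain1D {k p : ℕ} (q : ℕ) (S : Set (LocInt k p)) : Set (Config q k p) :=
  {x | x ≠ [] ∧ ∀ j : Fin x.length, (x.get j).2 ∈ S}

namespace ContextFreeGrammar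

variable {T : Type*} {g : ContextFreeGrammar T}

/-- `g.Yields s w` means that the sentential form `s` can be expanded to the terminal word `w`
by choosing a parse tree for each of its nonterminals. -/
inductive Yields (g : ContextFreeGrammar T) : List (Symbol T g.NT) → List T → Prop
  | nil : Yields g [] []
  | terminal (a : T) {s : List (Symbol T g.NT)} {w : List T} (hs : Yields g s w) :
      Yields g (Symbol.terminal a :: s) (a :: w)
  | nonterminal {r : ContextFreeRule T g.NT} (hr : r ∈ g.rules) {s : List (Symbol T g.NT)}
      {v w : List T} (ho : Yields g r.output v) (hs : Yields g s w) :
      Yields g (Symbol.nonterminal r.input :: s) (v ++ w)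

lemma Yields.append {s t : List (Symbol T g.NT)} {v w : List T} (hs : g.Yields s v)
    (ht : g.Yields t w) : g.Yields (s ++ t) (v ++ w) := by
  induction hs with
  | nil => exact ht
  | terminal a _ ih => exact ih.terminal a
  | nonterminal hr ho _ _ ih => simpa using Yields.nonterminal hr ho ih

lemma Yields.exists_of_append {s t : List (Symbol T g.NT)} {w : List T}
    (h : g.Yields (s ++ t) w) : ∃ v₁ v₂, w = v₁ ++ v₂ ∧ g.Yields s v₁ ∧ g.Yields t v₂ := by
  induction s generalizing w with
  | nil => exact ⟨[], w, rfl, .nil, h⟩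
  | cons a s ih =>
    cases h with
    | terminal a hs =>
      obtain ⟨v₁, v₂, rfl, h₁, h₂⟩ := ih hs
      exact ⟨a :: v₁, v₂, rfl, h₁.terminal a, h₂⟩
    | nonterminal hr ho hs =>
      obtain ⟨v₁, v₂, rfl, h₁, h₂⟩ := ih hs
      exact ⟨_ ++ v₁, v₂, by simp, .nonterminal hr ho h₁, h₂⟩

lemma yields_map_terminal (w : List T) : g.Yields (w.map Symbol.terminal) w := by
  induction w with
  | nil => exact .nil
  | cons a w ih => exact ih.terminal a

lemma Yields.of_produces {s t : List (Symbol T g.NT)} {w : List T} (h : g.Produces s t)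
    (ht : g.Yields t w) : g.Yields s w := by
  obtain ⟨r, hr, hst⟩ := h
  obtain ⟨a, b, rfl, rfl⟩ := hst.exists_parts
  obtain ⟨v, v₃, rfl, h, h₃⟩ := ht.exists_of_append
  obtain ⟨v₁, v₂, rfl, h₁, h₂⟩ := h.exists_of_append
  have hmid : g.Yields [Symbol.nonterminal r.input] v₂ := by
    simpa using Yields.nonterminal hr h₂ .nil
  exact (h₁.append hmid).append h₃

lemma Derives.yields {s : List (Symbol T g.NT)} {w : List T}
    (h : g.Derives s (w.map Symbol.terminal)) : g.Yields s w := by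
  induction h using Relation.ReflTransGen.head_induction_on with
  | refl => exact yields_map_terminal w
  | head hst _ ih => exact ih.of_produces hst

lemma derives_output {r : ContextFreeRule T g.NT} (hr : r ∈ g.rules) :
    g.Derives [Symbol.nonterminal r.input] r.output :=
  Produces.single ⟨r, hr, .input_output⟩

/-- Expansion of a nonterminal inside a sentential form. -/
lemma Derives.replace {s a b t : List (Symbol T g.NT)} {A : g.NT}
    (h : g.Derives s (a ++ [Symbol.nonterminal A] ++ b))
    (hA : g.Derives [Symbol.nonterminal A] t) : g.Derives s (a ++ t ++ b) :=
  h.trans ((hA.append_left a).append_right b)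

lemma Yields.derives {s : List (Symbol T g.NT)} {w : List T} (h : g.Yields s w) :
    g.Derives s (w.map Symbol.terminal) := by
  induction h with
  | nil => exact .refl _
  | terminal a _ ih => exact ih.append_left [Symbol.terminal a]
  | @nonterminal r hr s v w _ _ iho ihs =>
    rw [List.map_append]
    exact (((derives_output hr).trans iho).append_right s).trans (ihs.append_left _)

/-- A long yield of a sentential form contains the yield of a single nonterminal whose length lies
in a prescribed range. -/
lemma Yields.exists_subtree {m K : ℕ} (hm : ∀ r ∈ g.rules, r.output.length ≤ m) (hK : 0 < K)
    {s : List (Symbol T g.NT)} {w : List T} (h : g.Yields s w) (hw : s.length * K < w.length) :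
    ∃ r ∈ g.rules, ∃ u x z : List T, w = u ++ x ++ z ∧
      g.Derives s (u.map Symbol.terminal ++ [Symbol.nonterminal r.input] ++
        z.map Symbol.terminal) ∧
      g.Yields [Symbol.nonterminal r.input] x ∧ K < x.length ∧ x.length ≤ m * K := by
  induction h with
  | nil => simp at hw
  | terminal a _ ih =>
    simp only [List.length_cons, add_mul] at hw
    obtain ⟨r, hr, u, x, z, rfl, hd, hx⟩ := ih (by lia)
    exact ⟨r, hr, a :: u, x, z, rfl, hd.append_left [Symbol.terminal a], hx⟩
  | @nonterminal r hr s v w ho hs iho ihs =>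
    simp only [List.length_cons, add_mul, List.length_append, one_mul] at hw
    by_cases hs' : s.length * K < w.length
    · obtain ⟨r', hr', u, x, z, rfl, hd, hx⟩ := ihs hs'
      refine ⟨r', hr', v ++ u, x, z, by simp, ?_, hx⟩
      have hv := ((derives_output hr).trans ho.derives).append_right s
      simpa using hv.trans (hd.append_left (v.map Symbol.terminal))
    · by_cases hv : v.length ≤ m * K
      · refine ⟨r, hr, [], v, w, rfl, ?_, ?_, by lia, hv⟩
        · exact hs.derives.append_left [Symbol.nonterminal r.input]
        · simpa using Yields.nonterminal hr ho .nil
      · have := Nat.mul_le_mul_right K (hm r hr)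
        obtain ⟨r', hr', u, x, z, rfl, hd, hx⟩ := iho (by lia)
        refine ⟨r', hr', u, x, z ++ w, by simp, ?_, hx⟩
        have hd' := (((derives_output hr).trans hd).append_right s).trans
          (hs.derives.append_left _)
        simpa using hd'

/-- Iterating a self-embedding derivation of a nonterminal. -/
lemma Derives.iterate {A : g.NT} {v y : List T}
    (h : g.Derives [Symbol.nonterminal A]
      (v.map Symbol.terminal ++ [Symbol.nonterminal A] ++ y.map Symbol.terminal)) (i : ℕ) :
    g.Derives [Symbol.nonterminal A]
      ((List.replicate i v).flatten.map Symbol.terminal ++ [Symbol.nonterminal A] ++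
        (List.replicate i y).flatten.map Symbol.terminal) := by
  induction i with
  | zero => exact .refl _
  | succ i ih =>
    rw [List.replicate_succ' (a := v), List.replicate_succ (a := y)]
    simpa using ih.replace h

/-- The word `w` of length at most `N` below some nonterminal can be pumped inside a word of the
language: the induction behind the pumping lemma. The set `V` holds nonterminals already met
on the path from the root, and `k` bounds the number of the remaining ones. -/
lemma exists_pump_of_path [DecidableEq g.NT] {m N : ℕ} (hm : ∀ r ∈ g.rules, r.output.length ≤ m)
    (hpos : 0 < m) {W : List T} (k : ℕ) (V : Finset g.NT)
    (hV : (g.rules.image ContextFreeRule.input \ V).card ≤ k)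
    {r : ContextFreeRule T g.NT} (hr : r ∈ g.rules) {u x z : List T}
    (hW : W = u ++ x ++ z)
    (hroot : g.Derives [Symbol.nonterminal g.initial]
      (u.map Symbol.terminal ++ [Symbol.nonterminal r.input] ++ z.map Symbol.terminal))
    (hx : g.Yields [Symbol.nonterminal r.input] x) (hxk : m ^ k < x.length)
    (hxN : x.length ≤ N)
    (hpath : ∀ C ∈ V, ∃ u₀ v y z₀ : List T, u = u₀ ++ v ∧ z = y ++ z₀ ∧
      (v ++ x ++ y).length ≤ N ∧ 0 < v.length + y.length ∧
      g.Derives [Symbol.nonterminal g.initial]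
        (u₀.map Symbol.terminal ++ [Symbol.nonterminal C] ++ z₀.map Symbol.terminal) ∧
      g.Derives [Symbol.nonterminal C]
        (v.map Symbol.terminal ++ [Symbol.nonterminal r.input] ++ y.map Symbol.terminal)) :
    ∃ u v x y z : List T, W = u ++ v ++ x ++ y ++ z ∧ (v ++ x ++ y).length ≤ N ∧
      0 < v.length + y.length ∧
      ∀ i, u ++ (List.replicate i v).flatten ++ x ++ (List.replicate i y).flatten ++ z ∈
        g.language := by
  induction k using Nat.strong_induction_on generalizing V r u x z with | h k ih => ?_
  by_cases hrV : r.input ∈ V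
  · obtain ⟨u₀, v, y, z₀, rfl, rfl, hN, hvy, hC, hCC⟩ := hpath _ hrV
    refine ⟨u₀, v, x, y, z₀, by simp [hW], hN, hvy, fun i ↦ ?_⟩
    rw [mem_language_iff]
    simpa using hC.replace ((hCC.iterate i).replace hx.derives)
  have hmem : r.input ∈ g.rules.image ContextFreeRule.input \ V :=
    Finset.mem_sdiff.2 ⟨Finset.mem_image_of_mem _ hr, hrV⟩
  obtain ⟨k, rfl⟩ : ∃ l, k = l + 1 :=
    Nat.exists_eq_succ_of_ne_zero (by have := Finset.card_pos.2 ⟨_, hmem⟩; lia)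
  rw [pow_succ'] at hxk
  obtain ⟨r', hr', u', x', z', rfl, hd, hx', hlt, hle⟩ :=
    hx.exists_subtree hm (Nat.pow_pos (n := k) hpos)
      (by have := Nat.le_mul_of_pos_left (m ^ k) hpos; simpa using by lia)
  simp only [List.length_append] at hxk hxN
  refine ih k (Nat.lt_succ_self k) (insert r.input V) ?_ hr' (u := u ++ u') (x := x')
    (z := z' ++ z) (by simp [hW]) (by simpa using hroot.replace hd) hx' hlt (by lia) ?_
  · rw [Finset.sdiff_insert, Finset.card_erase_of_mem hmem]
    lia
  · intro C hC
    obtain rfl | hC := Finset.mem_insert.1 hC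
    · exact ⟨u, u', z', z, rfl, rfl, by simpa using by lia, by lia, hroot, hd⟩
    · obtain ⟨u₀, v, y, z₀, rfl, rfl, hN, hvy, hC₁, hC₂⟩ := hpath C hC
      simp only [List.length_append] at hN
      exact ⟨u₀, v ++ u', z' ++ y, z₀, by simp, by simp, by simpa using by lia,
        by simpa using by lia, hC₁, by simpa using hC₂.replace hd⟩

end ContextFreeGrammar

/-- The pumping lemma for context-free languages (Bar-Hillel lemma). -/
theorem Language.IsContextFree.pumping_lemma {T : Type*} {L : Language T} (hL : L.IsContextFree) :
    ∃ N : ℕ, ∀ w ∈ L, N ≤ w.length → ∃ u v x y z : List T, w = u ++ v ++ x ++ y ++ z ∧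
      (v ++ x ++ y).length ≤ N ∧ 0 < v.length + y.length ∧
      ∀ i, u ++ (List.replicate i v).flatten ++ x ++ (List.replicate i y).flatten ++ z ∈ L := by
  classical
  obtain ⟨g, rfl⟩ := hL
  obtain ⟨m, hm2, hm⟩ : ∃ m, 2 ≤ m ∧ ∀ r ∈ g.rules, r.output.length ≤ m :=
    ⟨g.rules.sup (fun r ↦ r.output.length) + 2, by lia, fun r hr ↦
      (Finset.le_sup (f := fun r : ContextFreeRule T g.NT ↦ r.output.length) hr).trans (by lia)⟩
  set k := (g.rules.image ContextFreeRule.input).card with hk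
  refine ⟨m * m ^ k, fun w hw hlen ↦ ?_⟩
  have hpos : 0 < m ^ k := Nat.pow_pos (by lia)
  have hmk : 2 * m ^ k ≤ m * m ^ k := Nat.mul_le_mul_right _ hm2
  obtain ⟨r, hr, u, x, z, hW, hd, hx, hlt, hle⟩ :=
    (ContextFreeGrammar.Derives.yields hw).exists_subtree hm hpos (by simpa using by lia)
  exact ContextFreeGrammar.exists_pump_of_path hm (by lia) k ∅ (by simp [hk]) hr hW hd hx hlt hle
    (by simp)

namespace List

variable {α : Type*}

/-- The splitting of a list at the first entry satisfying `p` is unique. -/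
lemma append_cons_inj_of_forall_not {p : α → Prop} {x₁ x₂ y₁ y₂ : List α} {a b : α}
    (h₁ : ∀ c ∈ x₁, ¬ p c) (h₂ : ∀ c ∈ x₂, ¬ p c) (ha : p a) (hb : p b)
    (h : x₁ ++ a :: y₁ = x₂ ++ b :: y₂) : x₁ = x₂ ∧ a = b ∧ y₁ = y₂ := by
  induction x₁ generalizing x₂ with
  | nil =>
    cases x₂ with
    | nil => simpa using h
    | cons c x₂ =>
      obtain ⟨rfl, -⟩ : a = c ∧ _ := by simpa using h
      exact absurd ha (h₂ a (by simp))
  | cons c x₁ ih =>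
    cases x₂ with
    | nil =>
      obtain ⟨rfl, -⟩ : c = b ∧ _ := by simpa using h
      exact absurd hb (h₁ c (by simp))
    | cons e x₂ =>
      simp only [cons_append, cons.injEq] at h
      obtain ⟨rfl, h⟩ := h
      simpa using ih (fun c hc ↦ h₁ c (by simp [hc])) (fun c hc ↦ h₂ c (by simp [hc])) h

lemma append_singleton_append_inj {c : α} {x₁ x₂ y₁ y₂ : List α} (h₁ : c ∉ x₁) (h₂ : c ∉ x₂)
    (h : x₁ ++ [c] ++ y₁ = x₂ ++ [c] ++ y₂) : x₁ = x₂ ∧ y₁ = y₂ := by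
  have := append_cons_inj_of_forall_not (p := (· = c)) (fun b hb hbc ↦ h₁ (hbc ▸ hb))
    (fun b hb hbc ↦ h₂ (hbc ▸ hb)) rfl rfl (by simpa using h)
  exact ⟨this.1, this.2.2⟩

/-- If removing two factors from `w ∘ w •` leaves a word `w' ∘ w' •`, then one factor is removed
from each copy of `w`, and the part between the two factors straddles the separator. -/
lemma exists_straddle_of_square {c d : α} (hcd : c ≠ d) {w w' u v x y z : List α} (hw : c ∉ w)
    (hw' : c ∉ w') (h : w ++ [c] ++ w ++ [d] = u ++ v ++ x ++ y ++ z)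
    (h' : w' ++ [c] ++ w' ++ [d] = u ++ x ++ z) (hvy : 0 < v.length + y.length) :
    ∃ x₁ x₂, x = x₁ ++ [c] ++ x₂ ∧ w = u ++ v ++ x₁ ∧ w' = u ++ x₁ ∧
      w ++ [d] = x₂ ++ y ++ z ∧ w' ++ [d] = x₂ ++ z := by
  classical
  have hcount := congrArg (count c) h
  have hcount' := congrArg (count c) h'
  simp [count_eq_zero_of_not_mem, hw, hw', hcd.symm] at hcount hcount'
  have hv : c ∉ v := count_eq_zero.1 (by lia)
  have hy : c ∉ y := count_eq_zero.1 (by lia)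
  have hne : w ≠ w' := by
    rintro rfl
    have := congrArg length (h.symm.trans h')
    simp only [length_append] at this
    lia
  by_cases hu : c ∈ u
  · obtain ⟨s, t, rfl, hs⟩ := eq_append_cons_of_mem hu
    have h₁ := append_singleton_append_inj (y₁ := w ++ [d]) (y₂ := t ++ v ++ x ++ y ++ z)
      hw hs (by simpa using h)
    have h₂ := append_singleton_append_inj (y₁ := w' ++ [d]) (y₂ := t ++ x ++ z)
      hw' hs (by simpa using h')
    exact absurd (h₁.1.trans h₂.1.symm) hne
  by_cases hx : c ∈ x
  · obtain ⟨s, t, rfl, hs⟩ := eq_append_cons_of_mem hx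
    have h₁ := append_singleton_append_inj (y₁ := w ++ [d]) (x₂ := u ++ v ++ s)
      (y₂ := t ++ y ++ z) hw (by simp [hu, hv, hs]) (by simpa using h)
    have h₂ := append_singleton_append_inj (y₁ := w' ++ [d]) (x₂ := u ++ s) (y₂ := t ++ z)
      hw' (by simp [hu, hs]) (by simpa using h')
    exact ⟨s, t, by simp, h₁.1, h₂.1, h₁.2, h₂.2⟩
  · have hz : c ∈ z := count_pos_iff.1 (by
      rw [count_eq_zero_of_not_mem hu, count_eq_zero_of_not_mem hx] at hcount'; lia)
    obtain ⟨s, t, rfl, hs⟩ := eq_append_cons_of_mem hz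
    have h₁ := append_singleton_append_inj (y₁ := w ++ [d]) (x₂ := u ++ v ++ x ++ y ++ s)
      (y₂ := t) hw (by simp [hu, hv, hx, hy, hs]) (by simpa using h)
    have h₂ := append_singleton_append_inj (y₁ := w' ++ [d]) (x₂ := u ++ x ++ s) (y₂ := t)
      hw' (by simp [hu, hx, hs]) (by simpa using h')
    exact absurd (append_cancel_right (h₁.2.trans h₂.2.symm)) hne

/-- Blocks closed by an end marker form a prefix code. -/
lemma prefix_of_flatten_prefix {p : α → Prop} {P X : List (List α)}
    (hP : ∀ b ∈ P, ∃ l a, b = l ++ [a] ∧ p a ∧ ∀ c ∈ l, ¬ p c)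
    (hX : ∀ b ∈ X, ∃ l a, b = l ++ [a] ∧ p a ∧ ∀ c ∈ l, ¬ p c)
    (h : P.flatten <+: X.flatten) : P <+: X := by
  induction P generalizing X with
  | nil => exact nil_prefix
  | cons b P ih =>
    obtain ⟨l, a, rfl, ha, hl⟩ := hP b (by simp)
    cases X with
    | nil => simp at h
    | cons b' X =>
      obtain ⟨l', a', rfl, ha', hl'⟩ := hX b' (by simp)
      obtain ⟨t, ht⟩ := h
      obtain ⟨rfl, rfl, ht'⟩ := append_cons_inj_of_forall_not (y₁ := P.flatten ++ t)
        (y₂ := X.flatten) hl hl' ha ha' (by simpa using ht)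
      exact (prefix_cons_inj _).2 (ih (fun b hb ↦ hP b (by simp [hb]))
        (fun b hb ↦ hX b (by simp [hb])) ⟨t, ht'⟩)

/-- Blocks opened by a start marker form a suffix code. -/
lemma suffix_of_flatten_suffix {p : α → Prop} {P X : List (List α)}
    (hP : ∀ b ∈ P, ∃ a l, b = a :: l ∧ p a ∧ ∀ c ∈ l, ¬ p c)
    (hX : ∀ b ∈ X, ∃ a l, b = a :: l ∧ p a ∧ ∀ c ∈ l, ¬ p c)
    (h : P.flatten <:+ X.flatten) : P <:+ X := by
  have key : ∀ {Y : List (List α)}, (∀ b ∈ Y, ∃ a l, b = a :: l ∧ p a ∧ ∀ c ∈ l, ¬ p c) →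
      ∀ b ∈ (Y.map reverse).reverse, ∃ l a, b = l ++ [a] ∧ p a ∧ ∀ c ∈ l, ¬ p c := by
    intro Y hY b hb
    obtain ⟨b, hb', rfl⟩ := mem_map.1 (mem_reverse.1 hb)
    obtain ⟨a, l, rfl, ha, hl⟩ := hY b hb'
    exact ⟨l.reverse, a, by simp, ha, by simpa using hl⟩
  rw [← reverse_prefix, reverse_flatten, reverse_flatten] at h
  have h' := prefix_of_flatten_prefix (key hP) (key hX) h
  rw [reverse_prefix] at h'
  simpa using h'.map reverse

lemma exists_eq_of_replicate_prefix_of_replicate_suffix {n : ℕ} {a b : α} {X : List α}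
    (hab : a ≠ b) (ha : replicate n a <+: X) (hb : replicate n b <:+ X) :
    ∃ t, X = replicate n a ++ t ++ replicate n b := by
  obtain ⟨s, rfl⟩ := ha
  obtain ⟨t, ht⟩ := hb
  obtain ⟨c, hc', hc⟩ | ⟨c, rfl, rfl⟩ := append_eq_append_iff.1 ht
  · cases c with
    | nil => exact ⟨[], by simpa using hc.symm⟩
    | cons e c =>
      have h₁ : e = a := eq_of_mem_replicate (n := n) (by simp [hc'])
      have h₂ : e = b := eq_of_mem_replicate (n := n) (by simp [hc])
      exact absurd (h₁.symm.trans h₂) hab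
  · exact ⟨c, by simp⟩

end List

lemma List.mem_of_mem_intercalate {α : Type*} {s : List α} {L : List (List α)} {a : α}
    (h : a ∈ s.intercalate L) : a ∈ s ∨ ∃ l ∈ L, a ∈ l := by
  induction L with
  | nil => simp at h
  | cons l L ih =>
    cases L with
    | nil => simpa using Or.inr h
    | cons l' L =>
      rw [List.intercalate_cons_cons, List.mem_append, List.mem_append] at h
      obtain (h | h) | h := h
      · exact .inr ⟨l, by simp, h⟩
      · exact .inl h
      · obtain h | ⟨b, hb, h⟩ := ih h
        · exact .inl h
        · exact .inr ⟨b, by simp [hb], h⟩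


section Encoding

variable {q k p : ℕ}

/-- The part of the encoding of a spin and its interaction between the opening spin symbol and the
closing `▷`. -/
def encBody (I : LocInt k p) : List (Symb q p) :=
  [Symb.ham I.1, Symb.lhd] ++
    List.intercalate [Symb.blank] (List.ofFn fun l => encAddr (I.2 l))

lemma mem_encAddr {a : Symb q p} {z : Option ℤ} (h : a ∈ encAddr z) :
    a = .dia ∨ a = .sq ∨ a = .tri := by
  cases z with
  | none => simp_all [encAddr]
  | some z =>
    rw [encAddr, unary] at h
    split_ifs at h
    · exact .inl (List.eq_of_mem_replicate h)
    · exact .inr (.inl (List.eq_of_mem_replicate h))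

lemma mem_encBody {I : LocInt k p} {a : Symb q p} (h : a ∈ encBody I) :
    (∀ s, a ≠ .spin s) ∧ a ≠ .rhd ∧ a ≠ .comp := by
  rw [encBody, List.mem_append] at h
  obtain h | h := h
  · simp only [List.mem_cons, List.not_mem_nil, or_false] at h
    obtain rfl | rfl := h <;> simp
  · obtain h | ⟨l, hl, h⟩ := List.mem_of_mem_intercalate h
    · simp_all
    · obtain ⟨i, rfl⟩ := List.mem_ofFn.1 hl
      obtain rfl | rfl | rfl := mem_encAddr h <;> simp

/-- The encoding of a spin together with its local interaction. -/
def encBlock (si : Fin q × LocInt k p) : List (Symb q p) :=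
  Symb.spin si.1 :: encInt si.2

lemma encBlock_eq (si : Fin q × LocInt k p) :
    encBlock si = Symb.spin si.1 :: (encBody si.2 ++ [Symb.rhd]) := rfl

lemma encConfig_eq (x : Config q k p) : encConfig x = (x.map encBlock).flatten := rfl

lemma comp_notMem_encConfig (x : Config q k p) : Symb.comp ∉ encConfig x := by
  rw [encConfig_eq]
  intro h
  obtain ⟨b, hb, h⟩ := List.mem_flatten.1 h
  obtain ⟨si, -, rfl⟩ := List.mem_map.1 hb
  rw [encBlock_eq] at h
  simp only [List.mem_cons, List.mem_append, reduceCtorEq, List.not_mem_nil, or_false,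
    false_or] at h
  exact (mem_encBody h).2.2 rfl

lemma encBlock_prefix_of_encConfig_prefix {x y : Config q k p}
    (h : encConfig x <+: encConfig y) : x.map encBlock <+: y.map encBlock := by
  have key : ∀ x : Config q k p, ∀ b ∈ x.map encBlock,
      ∃ l a, b = l ++ [a] ∧ a = Symb.rhd ∧ ∀ c ∈ l, ¬ c = Symb.rhd := by
    intro x b hb
    obtain ⟨si, -, rfl⟩ := List.mem_map.1 hb
    refine ⟨.spin si.1 :: encBody si.2, _, rfl, rfl, ?_⟩
    simpa using fun c hc ↦ (mem_encBody hc).2.1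
  exact List.prefix_of_flatten_prefix (key x) (key y) h

lemma encBlock_suffix_of_encConfig_suffix {x y : Config q k p}
    (h : encConfig x <:+ encConfig y) : x.map encBlock <:+ y.map encBlock := by
  have key : ∀ x : Config q k p, ∀ b ∈ x.map encBlock,
      ∃ a l, b = a :: l ∧ (∃ s, a = Symb.spin s) ∧ ∀ c ∈ l, ¬ ∃ s, c = Symb.spin s := by
    intro x b hb
    obtain ⟨si, -, rfl⟩ := List.mem_map.1 hb
    refine ⟨_, _, encBlock_eq si, ⟨_, rfl⟩, ?_⟩
    rintro c hc ⟨s, rfl⟩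
    obtain hc | hc := List.mem_append.1 hc
    · exact (mem_encBody hc).1 s rfl
    · simp at hc
  exact List.suffix_of_flatten_suffix (key x) (key y) h

lemma le_length_encConfig_replicate (n : ℕ) (c : Fin q × LocInt k p) :
    n ≤ (encConfig (List.replicate n c)).length := by
  simp only [encConfig_eq, List.map_replicate, List.length_flatten, List.sum_replicate,
    smul_eq_mul]
  exact Nat.le_mul_of_pos_right n (by simp [encBlock])

lemma encConfig_append (x y : Config q k p) : encConfig (x ++ y) = encConfig x ++ encConfig y := by
  simp [encConfig_eq]

/-- Two different blocks repeated `n` times at the two ends of an encoded configuration do not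
overlap. -/
lemma length_le_of_replicate_prefix_suffix {n : ℕ} {b c : Fin q × LocInt k p}
    (hbc : encBlock b ≠ encBlock c) {x : Config q k p}
    (hb : encConfig (List.replicate n b) <+: encConfig x)
    (hc : encConfig (List.replicate n c) <:+ encConfig x) :
    (encConfig (List.replicate n b ++ List.replicate n c)).length ≤ (encConfig x).length := by
  obtain ⟨t, ht⟩ := List.exists_eq_of_replicate_prefix_of_replicate_suffix hbc
    (by simpa using encBlock_prefix_of_encConfig_prefix hb)
    (by simpa using encBlock_suffix_of_encConfig_suffix hc)
  rw [encConfig_eq x, ht]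
  simp [encConfig_eq]

/-- The trivial time evolution is not context-free as soon as the domain contains the
configurations `bⁿcⁿ` for two spins with interactions `b`, `c` encoded differently. -/
theorem langU_not_contextFree_of_replicate_mem {D : Set (Config q k p)}
    {b c : Fin q × LocInt k p} (hbc : encBlock b ≠ encBlock c)
    (hD : ∀ n, 0 < n → List.replicate n b ++ List.replicate n c ∈ D) :
    ¬ (langU D).IsContextFree := by
  intro hL
  obtain ⟨N, hN⟩ := hL.pumping_lemma
  set n := N + 1 with hn
  have hlb := le_length_encConfig_replicate n b
  have hlc := le_length_encConfig_replicate n c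
  set x₀ := List.replicate n b ++ List.replicate n c with hx₀
  have hx₀' : encConfig x₀ =
      encConfig (List.replicate n b) ++ encConfig (List.replicate n c) := encConfig_append _ _
  have hlen := congrArg List.length hx₀'
  rw [List.length_append] at hlen
  obtain ⟨u, v, x, y, z, hW, hle, hvy, hpump⟩ := hN _ ⟨x₀, hD n (by lia), rfl⟩
    (by simp only [List.length_append]; lia)
  obtain ⟨x', -, hW'⟩ := hpump 0
  simp only [List.replicate_zero, List.flatten_nil, List.append_nil] at hW'
  obtain ⟨x₁, x₂, rfl, h₁, h₁', h₂, h₂'⟩ := List.exists_straddle_of_square (by simp)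
    (comp_notMem_encConfig x₀) (comp_notMem_encConfig x') hW hW'.symm hvy
  have l₁ := congrArg List.length h₁
  have l₁' := congrArg List.length h₁'
  have l₂ := congrArg List.length h₂
  have l₂' := congrArg List.length h₂'
  simp only [List.length_append, List.length_singleton] at l₁ l₁' l₂ l₂' hle
  have hpre : encConfig (List.replicate n b) <+: encConfig x' := by
    have hu : encConfig (List.replicate n b) <+: u :=
      List.prefix_of_prefix_length_le (l₃ := encConfig x₀) (hx₀' ▸ List.prefix_append _ _)
        ⟨v ++ x₁, by simp [h₁]⟩ (by lia)
    exact hu.trans ⟨x₁, h₁'.symm⟩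
  have hsuf : encConfig (List.replicate n c) <:+ encConfig x' := by
    have hz : encConfig (List.replicate n c) ++ [Symb.bullet] <:+ z :=
      List.suffix_of_suffix_length_le (l₃ := encConfig x₀ ++ [Symb.bullet])
        ⟨encConfig (List.replicate n b), by simp [hx₀']⟩
        ⟨x₂ ++ y, h₂.symm⟩ (by simp only [List.length_append, List.length_singleton]; lia)
    obtain ⟨t, ht⟩ := hz.trans ⟨x₂, h₂'.symm⟩
    exact ⟨t, List.append_cancel_right (by simpa using ht)⟩
  have := length_le_of_replicate_prefix_suffix hbc hpre hsuf
  lia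

end Encoding

/-- If `H` is a 1D spin Hamiltonian with more than one spin symbol
(`q > 1`), or with more than one allowed local interaction with distinct encodings, then
the language `L_U` of its trivial time evolution is not context-free. -/
theorem langU_oneD_not_contextFree {q k p : ℕ} (hq : 0 < q) (hk : 0 < k) (hp : 0 < p)
    (h : Fin p → (Fin k → Option (Fin q)) → ℤ)
    (S : Set (LocInt k p)) (hS : Is1DIntSet S)
    (hbig : 1 < q ∨ ∃ I ∈ S, ∃ I' ∈ S, encInt (q := q) I ≠ encInt I') :
    ¬ (langU (Domain1D q S)).IsContextFree := by
  have hD : ∀ b c : Fin q × LocInt k p, b.2 ∈ S → c.2 ∈ S → ∀ n, 0 < n →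
      List.replicate n b ++ List.replicate n c ∈ Domain1D q S := by
    intro b c hb hc n hn
    refine ⟨by simp [hn.ne'], fun j ↦ ?_⟩
    have hj := List.get_mem (List.replicate n b ++ List.replicate n c) j
    obtain hj | hj := List.mem_append.1 hj
    · rwa [List.eq_of_mem_replicate hj]
    · rwa [List.eq_of_mem_replicate hj]
  obtain hq | ⟨I, hI, I', hI', hne⟩ := hbig
  · obtain ⟨I, hI⟩ := hS.1
    exact langU_not_contextFree_of_replicate_mem (b := (⟨0, by lia⟩, I)) (c := (⟨1, hq⟩, I))
      (by simp [encBlock]) (hD _ _ hI hI)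
  · exact langU_not_contextFree_of_replicate_mem (b := (⟨0, hq⟩, I)) (c := (⟨0, hq⟩, I'))
      (by simpa [encBlock] using hne) (hD _ _ hI hI')
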